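/- (Theorem 1, first bound) Let X and E be m×n quaternion matrices and set X̃ = X + E. Fix a column-selection map c : {1,…,s} → {1,…,n} and a row-selection map r : {1,…,t} → {1,…,m}, and let C = X(:,J), R = X(I,:), C̃ = X̃(:,J), R̃ = X̃(I,:), E_J = E(:,J), E_I = E(I,:). Let C⁺, R⁺, C̃⁺, R̃⁺ be Moore–Penrose pseudoinverses of C, R, C̃, R̃ respectively, and assume X = C C⁺ X and X = X R⁺ R. Then ‖X − C̃ C̃⁺ X̃ R̃⁺ R̃‖_F ≤ ‖E_I‖_F · ‖X R⁺‖_F + ‖E_J‖_F · ‖C⁺ X‖_F + 3 ‖E‖_F. -/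

import Mathlib

open Matrix

/-- The Frobenius norm of a quaternion matrix: `√(∑ i j, |A i j|²)`. -/
noncomputable def frobNorm {α β : Type*} [Fintype α] [Fintype β]
    (A : Matrix α β (Quaternion ℝ)) : ℝ :=
  Real.sqrt (∑ i, ∑ j, ‖A i j‖ ^ 2)

/-- `U` is a Moore–Penrose pseudoinverse of `A`:
`A U A = A`, `U A U = U`, `(A U)ᴴ = A U`, `(U A)ᴴ = U A`. -/
def IsMoorePenrose {α β : Type*} [Fintype α] [Fintype β]
    (A : Matrix α β (Quaternion ℝ)) (U : Matrix β α (Quaternion ℝ)) : Prop :=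
  A * U * A = A ∧ U * A * U = U ∧ (A * U)ᴴ = A * U ∧ (U * A)ᴴ = U * A

theorem my_le_of_sq {a b : ℝ} (h : a ^ 2 ≤ b ^ 2) (hb : 0 ≤ b) : a ≤ b := by
  by_contra hc
  nlinarith [not_le.mp hc]

theorem quat_re_sum {ι : Type*} (s : Finset ι) (f : ι → Quaternion ℝ) :
    (∑ i ∈ s, f i).re = ∑ i ∈ s, (f i).re := by
  classical
  induction s using Finset.induction_on with
  | empty => simp only [Finset.sum_empty]; rfl
  | insert a s ha ih => rw [Finset.sum_insert ha, Finset.sum_insert ha, Quaternion.re_add, ih]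

open scoped Matrix.Norms.Frobenius in
theorem frobNorm_eq {α β : Type*} [Fintype α] [Fintype β]
    (A : Matrix α β (Quaternion ℝ)) : frobNorm A = ‖A‖ := by
  rw [Matrix.frobenius_norm_def, frobNorm, Real.sqrt_eq_rpow]
  simp

open scoped Matrix.Norms.Frobenius in
theorem frobNorm_add_le {α β : Type*} [Fintype α] [Fintype β]
    (A B : Matrix α β (Quaternion ℝ)) : frobNorm (A + B) ≤ frobNorm A + frobNorm B := by
  simp only [frobNorm_eq]
  exact norm_add_le A B

theorem frobNorm_neg {α β : Type*} [Fintype α] [Fintype β]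
    (A : Matrix α β (Quaternion ℝ)) : frobNorm (-A) = frobNorm A := by
  simp [frobNorm]

theorem frobNorm_conjTranspose {α β : Type*} [Fintype α] [Fintype β]
    (A : Matrix α β (Quaternion ℝ)) : frobNorm Aᴴ = frobNorm A := by
  unfold frobNorm
  rw [Finset.sum_comm]
  simp [Matrix.conjTranspose_apply]

theorem frobNorm_nonneg {α β : Type*} [Fintype α] [Fintype β]
    (A : Matrix α β (Quaternion ℝ)) : 0 ≤ frobNorm A := Real.sqrt_nonneg _

theorem frobNorm_sq {α β : Type*} [Fintype α] [Fintype β]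
    (A : Matrix α β (Quaternion ℝ)) : frobNorm A ^ 2 = ∑ i, ∑ j, ‖A i j‖ ^ 2 :=
  Real.sq_sqrt (by positivity)

theorem frobNorm_mul_le {α β γ : Type*} [Fintype α] [Fintype β] [Fintype γ]
    (A : Matrix α β (Quaternion ℝ)) (B : Matrix β γ (Quaternion ℝ)) :
    frobNorm (A * B) ≤ frobNorm A * frobNorm B := by
  refine my_le_of_sq ?_ (mul_nonneg (frobNorm_nonneg _) (frobNorm_nonneg _))
  rw [mul_pow, frobNorm_sq, frobNorm_sq, frobNorm_sq,
    Finset.sum_comm (f := fun i j => ‖B i j‖ ^ 2), Finset.sum_mul_sum]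
  refine Finset.sum_le_sum fun i _ => Finset.sum_le_sum fun k _ => ?_
  have h1 : ‖(A * B) i k‖ ≤ ∑ j, ‖A i j‖ * ‖B j k‖ := by
    rw [Matrix.mul_apply]
    exact (norm_sum_le _ _).trans (le_of_eq (by simp))
  calc ‖(A * B) i k‖ ^ 2 ≤ (∑ j, ‖A i j‖ * ‖B j k‖) ^ 2 := by gcongr
    _ ≤ _ := Finset.sum_mul_sq_le_sq_mul_sq _ _ _

theorem frobNorm_sq_trace {α β : Type*} [Fintype α] [Fintype β]
    (A : Matrix α β (Quaternion ℝ)) : frobNorm A ^ 2 = (∑ j, (Aᴴ * A) j j).re := by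
  rw [frobNorm_sq, Finset.sum_comm, quat_re_sum]
  refine Finset.sum_congr rfl fun j _ => ?_
  rw [Matrix.mul_apply, quat_re_sum]
  refine Finset.sum_congr rfl fun i _ => ?_
  rw [Matrix.conjTranspose_apply, Quaternion.star_mul_self, pow_two,
    ← Quaternion.normSq_eq_norm_mul_self]
  simp

theorem frobNorm_pyth {α β : Type*} [Fintype α] [Fintype β]
    (P : Matrix α α (Quaternion ℝ)) (hP : P * P = P) (hH : Pᴴ = P)
    (A : Matrix α β (Quaternion ℝ)) :
    frobNorm A ^ 2 = frobNorm (P * A) ^ 2 + frobNorm (A - P * A) ^ 2 := by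
  have h : Aᴴ * A = (P * A)ᴴ * (P * A) + (A - P * A)ᴴ * (A - P * A) := by
    have h2 : Aᴴ * P * (P * A) = Aᴴ * (P * A) := by
      rw [Matrix.mul_assoc, ← Matrix.mul_assoc P P A, hP]
    rw [Matrix.conjTranspose_sub, Matrix.conjTranspose_mul, hH, Matrix.sub_mul,
      Matrix.mul_sub, Matrix.mul_sub, h2, Matrix.mul_assoc Aᴴ P A]
    abel
  simp only [frobNorm_sq_trace]
  rw [h]
  simp only [Matrix.add_apply, Finset.sum_add_distrib, Quaternion.re_add]

theorem frobNorm_proj_le {α β : Type*} [Fintype α] [Fintype β]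
    (P : Matrix α α (Quaternion ℝ)) (hP : P * P = P) (hH : Pᴴ = P)
    (A : Matrix α β (Quaternion ℝ)) :
    frobNorm (P * A) ≤ frobNorm A ∧ frobNorm (A - P * A) ≤ frobNorm A := by
  have h := frobNorm_pyth P hP hH A
  constructor <;> refine my_le_of_sq ?_ (frobNorm_nonneg _) <;>
    nlinarith [sq_nonneg (frobNorm (P * A)), sq_nonneg (frobNorm (A - P * A))]

theorem frobNorm_proj_le_right {α β : Type*} [Fintype α] [Fintype β]
    (P : Matrix α α (Quaternion ℝ)) (hP : P * P = P) (hH : Pᴴ = P)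
    (A : Matrix β α (Quaternion ℝ)) :
    frobNorm (A * P) ≤ frobNorm A ∧ frobNorm (A - A * P) ≤ frobNorm A := by
  have h := frobNorm_proj_le P hP hH Aᴴ
  have e : P * Aᴴ = (A * P)ᴴ := by rw [Matrix.conjTranspose_mul, hH]
  rw [e, ← Matrix.conjTranspose_sub] at h
  simpa only [frobNorm_conjTranspose] using h

/-- Theorem 1, first bound. -/
theorem quaternion_CUR_perturbation_bound {m n s t : ℕ}
    (X E : Matrix (Fin m) (Fin n) (Quaternion ℝ))
    (Xt : Matrix (Fin m) (Fin n) (Quaternion ℝ)) (hXt : Xt = X + E)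
    (c : Fin s → Fin n) (r : Fin t → Fin m)
    (C : Matrix (Fin m) (Fin s) (Quaternion ℝ)) (hC : C = X.submatrix id c)
    (R : Matrix (Fin t) (Fin n) (Quaternion ℝ)) (hR : R = X.submatrix r id)
    (Ct : Matrix (Fin m) (Fin s) (Quaternion ℝ)) (hCt : Ct = Xt.submatrix id c)
    (Rt : Matrix (Fin t) (Fin n) (Quaternion ℝ)) (hRt : Rt = Xt.submatrix r id)
    (EJ : Matrix (Fin m) (Fin s) (Quaternion ℝ)) (hEJ : EJ = E.submatrix id c)
    (EI : Matrix (Fin t) (Fin n) (Quaternion ℝ)) (hEI : EI = E.submatrix r id)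
    (Cp : Matrix (Fin s) (Fin m) (Quaternion ℝ)) (hCp : IsMoorePenrose C Cp)
    (Rp : Matrix (Fin n) (Fin t) (Quaternion ℝ)) (hRp : IsMoorePenrose R Rp)
    (Ctp : Matrix (Fin s) (Fin m) (Quaternion ℝ)) (hCtp : IsMoorePenrose Ct Ctp)
    (Rtp : Matrix (Fin n) (Fin t) (Quaternion ℝ)) (hRtp : IsMoorePenrose Rt Rtp)
    (hXCC : X = C * Cp * X) (hXRR : X = X * Rp * R) :
    frobNorm (X - Ct * Ctp * Xt * Rtp * Rt) ≤
      frobNorm EI * frobNorm (X * Rp) + frobNorm EJ * frobNorm (Cp * X) +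
        3 * frobNorm E := by
  obtain ⟨c1, -, c3, -⟩ := hCtp
  obtain ⟨r1, -, -, r4⟩ := hRtp
  have hCE : Ct = C + EJ := by rw [hCt, hC, hEJ, hXt]; rfl
  have hRE : Rt = R + EI := by rw [hRt, hR, hEI, hXt]; rfl
  have hP : (Ct * Ctp) * (Ct * Ctp) = Ct * Ctp := by rw [← Matrix.mul_assoc, c1]
  have hQ : (Rtp * Rt) * (Rtp * Rt) = Rtp * Rt := by
    rw [Matrix.mul_assoc, ← Matrix.mul_assoc Rt, r1]
  have hQR : Rt * (Rtp * Rt) = Rt := by rw [← Matrix.mul_assoc, r1]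
  have hassoc : Ct * Ctp * Xt * Rtp * Rt = Ct * Ctp * Xt * (Rtp * Rt) := by
    rw [Matrix.mul_assoc]
  rw [hassoc]
  generalize Ct * Ctp = P at *
  generalize Rtp * Rt = Q at *
  have hC' : C = Ct - EJ := by rw [hCE]; abel
  have hR' : R = Rt - EI := by rw [hRE]; abel
  have e1 : X - P * X = -(EJ * (Cp * X) - P * (EJ * (Cp * X))) := by
    have hx : X = Ct * (Cp * X) - EJ * (Cp * X) := by
      rw [← Matrix.sub_mul, ← hC', ← Matrix.mul_assoc, ← hXCC]
    have hp : P * X = Ct * (Cp * X) - P * (EJ * (Cp * X)) := by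
      conv_lhs => rw [hx]
      rw [Matrix.mul_sub, ← Matrix.mul_assoc P Ct, c1]
    rw [hp]
    nth_rewrite 1 [hx]
    abel
  have e2 : X - X * Q = -(X * Rp * EI - X * Rp * EI * Q) := by
    have hx : X = X * Rp * Rt - X * Rp * EI := by
      rw [← Matrix.mul_sub, ← hR', ← hXRR]
    have hp : X * Q = X * Rp * Rt - X * Rp * EI * Q := by
      conv_lhs => rw [hx]
      rw [Matrix.sub_mul, Matrix.mul_assoc (X * Rp) Rt Q, hQR]
    rw [hp]
    nth_rewrite 1 [hx]
    abel
  have e : X - P * Xt * Q = (X - P * X) + P * (X - X * Q) + -(P * (E * Q)) := by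
    rw [hXt, Matrix.mul_sub, Matrix.mul_add, Matrix.add_mul, Matrix.mul_assoc P X Q,
      Matrix.mul_assoc P E Q]
    abel
  have b1 : frobNorm (X - P * X) ≤ frobNorm EJ * frobNorm (Cp * X) := by
    rw [e1, frobNorm_neg]
    exact (frobNorm_proj_le P hP c3 _).2.trans (frobNorm_mul_le _ _)
  have b2 : frobNorm (P * (X - X * Q)) ≤ frobNorm EI * frobNorm (X * Rp) := by
    refine (frobNorm_proj_le P hP c3 _).1.trans ?_
    rw [e2, frobNorm_neg, mul_comm]
    exact (frobNorm_proj_le_right Q hQ r4 _).2.trans (frobNorm_mul_le _ _)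
  have b3 : frobNorm (-(P * (E * Q))) ≤ frobNorm E := by
    rw [frobNorm_neg]
    exact (frobNorm_proj_le P hP c3 _).1.trans (frobNorm_proj_le_right Q hQ r4 _).1
  have t1 := frobNorm_add_le ((X - P * X) + P * (X - X * Q)) (-(P * (E * Q)))
  have t2 := frobNorm_add_le (X - P * X) (P * (X - X * Q))
  rw [← e] at t1
  have := frobNorm_nonneg E
  linarith
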